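/- arXiv:2201.10014 — 4 statements merged into one kernel-verified Lean document; each statement's English description precedes it below -/
import Mathlib

section
/- Let 0 < α and let p, q ∈ (0, α]. Then p·log(p/q) − (p − q) ≥ (p − q)²/(2α). -/
/-- On `[1, ∞)` the logarithm is at most `(s - s⁻¹) / 2`. -/
theorem Real.log_le_half_sub_inv {s : ℝ} (hs : 1 ≤ s) : Real.log s ≤ (s - s⁻¹) / 2 := by
  have h := Real.self_le_sinh_iff.mpr (Real.log_nonneg hs)
  rwa [Real.sinh_log (by linarith)] at h

/-- On `[1, ∞)` the logarithm is at least `2 (t - 1) / (t + 1)`. -/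
theorem Real.two_mul_sub_one_div_add_one_le_log {t : ℝ} (ht : 1 ≤ t) :
    2 * (t - 1) / (t + 1) ≤ Real.log t := by
  have h := Real.le_log_one_add_of_nonneg (sub_nonneg.mpr ht)
  rwa [show t - 1 + 2 = t + 1 by ring, add_sub_cancel] at h

/-- KL lower bound for Poisson distributions (Lemma A.5):
for `p, q ∈ (0, α]`, `p·log(p/q) − (p − q) ≥ (p − q)²/(2α)`. -/
theorem poisson_kl_lower_bound (α p q : ℝ) (hα : 0 < α)
    (hp : 0 < p) (hpα : p ≤ α) (hq : 0 < q) (hqα : q ≤ α) :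
    p * Real.log (p / q) - (p - q) ≥ (p - q) ^ 2 / (2 * α) := by
  rcases le_total q p with hqp | hpq
  · calc (p - q) ^ 2 / (2 * α) ≤ (p - q) ^ 2 / (p + q) := by gcongr; linarith
      _ = p * (2 * (p / q - 1) / (p / q + 1)) - (p - q) := by field_simp; ring
      _ ≤ p * Real.log (p / q) - (p - q) := by
        gcongr
        exact Real.two_mul_sub_one_div_add_one_le_log ((one_le_div hq).mpr hqp)
  · calc (p - q) ^ 2 / (2 * α) ≤ (p - q) ^ 2 / (2 * q) := by gcongr
      _ = p * -((q / p - (q / p)⁻¹) / 2) - (p - q) := by field_simp; ring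
      _ ≤ p * -Real.log (q / p) - (p - q) := by
        gcongr
        exact Real.log_le_half_sub_inv ((one_le_div hp).mpr hpq)
      _ = p * Real.log (p / q) - (p - q) := by rw [← Real.log_inv, inv_div]
end

section
/- For all real numbers p, q > 0, one has p·log(p/q) − (p − q) ≥ (p − q)²/(2·max(p, q)). -/
/-- The second-order Taylor polynomial at `1` bounds the logarithm from above on `(0, 1]`. -/
theorem log_le_sub_one_sub_sq_div_two {t : ℝ} (ht : 0 < t) (ht1 : t ≤ 1) :
    Real.log t ≤ (t - 1) - (t - 1) ^ 2 / 2 := by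
  have hx : |1 - t| < 1 := by rw [abs_lt]; constructor <;> linarith
  have hs := sum_le_hasSum (Finset.range 2)
    (fun i _ => div_nonneg (pow_nonneg (sub_nonneg.2 ht1) (i + 1)) (by positivity))
    (Real.hasSum_pow_div_log_of_abs_lt_one hx)
  norm_num [Finset.sum_range_succ] at hs
  linarith

/-- A lower bound on the logarithm on `(0, 1]`, from `sinh x ≤ x` for `x ≤ 0`. -/
theorem sub_inv_div_two_le_log {t : ℝ} (ht : 0 < t) (ht1 : t ≤ 1) :
    (t - t⁻¹) / 2 ≤ Real.log t := by
  rw [← Real.sinh_log ht]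
  exact Real.sinh_le_self_iff.2 (Real.log_nonpos ht.le ht1)

/-- Strengthened KL lower bound for Poisson distributions:
for `p, q > 0`, `p·log(p/q) − (p − q) ≥ (p − q)²/(2·max(p,q))`. -/
theorem poisson_kl_lower_bound_max (p q : ℝ) (hp : 0 < p) (hq : 0 < q) :
    p * Real.log (p / q) - (p - q) ≥ (p - q) ^ 2 / (2 * max p q) := by
  rcases le_total q p with h | h
  · have key := mul_le_mul_of_nonneg_left
      (log_le_sub_one_sub_sq_div_two (div_pos hq hp) ((div_le_one hp).2 h)) hp.le
    have e : p * ((q / p - 1) - (q / p - 1) ^ 2 / 2) = (q - p) - (p - q) ^ 2 / (2 * p) := by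
      field_simp
      ring
    rw [max_eq_left h, ← inv_div q p, Real.log_inv]
    linarith
  · have key := mul_le_mul_of_nonneg_left
      (sub_inv_div_two_le_log (div_pos hp hq) ((div_le_one hq).2 h)) hp.le
    have e : p * ((p / q - (p / q)⁻¹) / 2) = (p - q) + (p - q) ^ 2 / (2 * q) := by
      field_simp
      ring
    rw [max_eq_right h]
    linarith
end

section
/- Let 0 < β ≤ α and let p, q ∈ [β, α]. Then (1 − e^{−p})·D₀(p‖q) ≥ ((e^β − β − 1)/(2α(e^β − 1)))·(p − q)² ≥ 0. -/
/-- KL divergence between two zero-truncated Poisson distributions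
with parameters `p, q > 0`. -/
noncomputable def ztpKL (p q : ℝ) : ℝ :=
  p / (1 - Real.exp (-p)) * Real.log (p / q) -
    (Real.log (Real.exp p - 1) - Real.log (Real.exp q - 1))

/-- The trapezoid bound for `exp` on `[0, d]`. -/
theorem two_mul_exp_sub_one_le {d : ℝ} (hd : 0 ≤ d) :
    2 * (Real.exp d - 1) ≤ d * (Real.exp d + 1) := by
  have hderiv : ∀ x : ℝ, HasDerivAt (fun x => x * (Real.exp x + 1) - 2 * (Real.exp x - 1))
      (1 * (Real.exp x + 1) + x * Real.exp x - 2 * Real.exp x) x := fun x =>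
    ((hasDerivAt_id' x).mul ((Real.hasDerivAt_exp x).add_const 1)).sub
      (((Real.hasDerivAt_exp x).sub_const 1).const_mul 2)
  have hmono : Monotone fun x : ℝ => x * (Real.exp x + 1) - 2 * (Real.exp x - 1) := by
    refine monotone_of_hasDerivAt_nonneg hderiv fun x => ?_
    have h1 := Real.add_one_le_exp (-x)
    have h2 : Real.exp x * Real.exp (-x) = 1 := by rw [← Real.exp_add]; simp
    have h3 := mul_le_mul_of_nonneg_left h1 (Real.exp_pos x).le
    simp only [Pi.zero_apply]
    linarith
  have h := hmono hd
  simp only [Real.exp_zero] at h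
  linarith

/-- The function `x ↦ x / (exp x - 1)` is antitone on the positive reals. -/
theorem div_exp_sub_one_le {a x : ℝ} (ha : 0 < a) (hax : a ≤ x) :
    x / (Real.exp x - 1) ≤ a / (Real.exp a - 1) := by
  have hx : 0 < x := ha.trans_le hax
  have h := convexOn_exp.2 (Set.mem_univ x) (Set.mem_univ 0) (div_nonneg ha.le hx.le)
    (sub_nonneg.2 ((div_le_one hx).2 hax)) (add_sub_cancel _ _)
  simp only [smul_eq_mul, mul_zero, add_zero, Real.exp_zero, mul_one,
    div_mul_cancel₀ a hx.ne'] at h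
  have hA : 0 < Real.exp a - 1 := sub_pos.2 (Real.one_lt_exp_iff.2 ha)
  have hX : 0 < Real.exp x - 1 := sub_pos.2 (Real.one_lt_exp_iff.2 hx)
  rw [div_le_div_iff₀ hX hA]
  have h' : Real.exp a - 1 ≤ a / x * (Real.exp x - 1) := by linarith
  calc x * (Real.exp a - 1) ≤ x * (a / x * (Real.exp x - 1)) :=
        mul_le_mul_of_nonneg_left h' hx.le
    _ = a * (Real.exp x - 1) := by field_simp

/-- The function `x ↦ (exp x - 1) / x` is supermultiplicative on the positive reals
(stated without division by `d`). -/
theorem add_div_exp_sub_one_mul_le {d p : ℝ} (hd : 0 ≤ d) (hp : 0 < p) :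
    (d + p) / (Real.exp (d + p) - 1) * (Real.exp d - 1) ≤ p / (Real.exp p - 1) * d := by
  have hP : 0 < Real.exp p - 1 := sub_pos.2 (Real.one_lt_exp_iff.2 hp)
  have hD : 0 ≤ Real.exp d - 1 := sub_nonneg.2 (Real.one_le_exp hd)
  have hX : 0 < Real.exp (d + p) - 1 := sub_pos.2 (Real.one_lt_exp_iff.2 (by linarith))
  rw [div_mul_eq_mul_div, div_mul_eq_mul_div, div_le_div_iff₀ hX hP, Real.exp_add]
  have h1 := mul_le_mul_of_nonneg_left (two_mul_exp_sub_one_le hd) (mul_nonneg hp.le hP.le)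
  have h2 := mul_le_mul_of_nonneg_left (two_mul_exp_sub_one_le hp.le) (mul_nonneg hd hD)
  linarith

/-- `(1 - exp (-p)) * ztpKL p x` has derivative `(x - p - x / (exp x - 1) * (exp (x - p) - 1)) / x`
in `x`. -/
theorem hasDerivAt_one_sub_exp_mul_ztpKL {p x : ℝ} (hp : 0 < p) (hx : 0 < x) :
    HasDerivAt (fun y => (1 - Real.exp (-p)) * ztpKL p y)
      ((x - p - x / (Real.exp x - 1) * (Real.exp (x - p) - 1)) / x) x := by
  have hX : 0 < Real.exp x - 1 := sub_pos.2 (Real.one_lt_exp_iff.2 hx)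
  have hP : 0 < Real.exp p - 1 := sub_pos.2 (Real.one_lt_exp_iff.2 hp)
  have hinner : HasDerivAt (fun y => p / y) (-p / x ^ 2) x := by
    simpa [div_eq_mul_inv] using (hasDerivAt_inv hx.ne').const_mul p
  have h := (((hinner.log (div_pos hp hx).ne').const_mul (p / (1 - Real.exp (-p)))).sub
    ((((Real.hasDerivAt_exp x).sub_const 1).log hX.ne').const_sub
      (Real.log (Real.exp p - 1)))).const_mul (1 - Real.exp (-p))
  unfold ztpKL
  refine h.congr_deriv ?_
  rw [Real.exp_neg, Real.exp_sub]
  have hP0 := Real.exp_pos p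
  have hne : 1 - (Real.exp p)⁻¹ ≠ 0 := by
    rw [show 1 - (Real.exp p)⁻¹ = (Real.exp p - 1) / Real.exp p by field_simp]
    positivity
  field_simp
  ring

/-- Lemma A.3 (KL lower bound for zero-truncated Poisson distributions):
for `0 < β ≤ α` and `p, q ∈ [β, α]`,
`(1 − e^{−p})·D₀(p‖q) ≥ ((e^β − β − 1)/(2α(e^β − 1)))·(p − q)² ≥ 0`. -/
theorem ztp_kl_lower_bound (α β p q : ℝ) (hβ : 0 < β) (hβα : β ≤ α)
    (hp : p ∈ Set.Icc β α) (hq : q ∈ Set.Icc β α) :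
    (1 - Real.exp (-p)) * ztpKL p q ≥
      (Real.exp β - β - 1) / (2 * α * (Real.exp β - 1)) * (p - q) ^ 2 ∧
    (Real.exp β - β - 1) / (2 * α * (Real.exp β - 1)) * (p - q) ^ 2 ≥ 0 := by
  obtain ⟨hβp, hpα⟩ := hp
  obtain ⟨hβq, hqα⟩ := hq
  have hp0 : 0 < p := hβ.trans_le hβp
  have hα0 : 0 < α := hβ.trans_le hβα
  have hB : 0 < Real.exp β - 1 := sub_pos.2 (Real.one_lt_exp_iff.2 hβ)
  have hk : 0 ≤ 1 - β / (Real.exp β - 1) := by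
    rw [sub_nonneg, div_le_one hB]
    linarith [Real.add_one_le_exp β]
  have hc : (Real.exp β - β - 1) / (2 * α * (Real.exp β - 1)) =
      (1 - β / (Real.exp β - 1)) / (2 * α) := by
    field_simp
    ring
  rw [hc]
  refine ⟨?_, by positivity⟩
  set k := 1 - β / (Real.exp β - 1) with hkdef
  have hderiv : ∀ x, 0 < x → HasDerivAt
      (fun y => (1 - Real.exp (-p)) * ztpKL p y - k / (2 * α) * (p - y) ^ 2)
      ((x - p - x / (Real.exp x - 1) * (Real.exp (x - p) - 1)) / x - k * (x - p) / α) x := by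
    intro x hx
    refine ((hasDerivAt_one_sub_exp_mul_ztpKL hp0 hx).sub
      ((((hasDerivAt_id' x).const_sub p).pow 2).const_mul (k / (2 * α)))).congr_deriv ?_
    field_simp
    ring
  have hzero : (1 - Real.exp (-p)) * ztpKL p p - k / (2 * α) * (p - p) ^ 2 = 0 := by
    simp [ztpKL, hp0.ne']
  suffices h : (1 - Real.exp (-p)) * ztpKL p p - k / (2 * α) * (p - p) ^ 2 ≤
      (1 - Real.exp (-p)) * ztpKL p q - k / (2 * α) * (p - q) ^ 2 by linarith
  rcases le_total p q with hpq | hqp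
  · refine monotoneOn_of_hasDerivWithinAt_nonneg (convex_Icc p q)
      (fun x hx => (hderiv x (hp0.trans_le hx.1)).continuousAt.continuousWithinAt)
      (fun x hx => (hderiv x (hp0.trans_le (interior_subset hx).1)).hasDerivWithinAt)
      (fun x hx => ?_) (Set.left_mem_Icc.2 hpq) (Set.right_mem_Icc.2 hpq) hpq
    obtain ⟨hpx, hxq⟩ := interior_subset hx
    have hx0 : 0 < x := hp0.trans_le hpx
    have hd : 0 ≤ x - p := sub_nonneg.2 hpx
    have h1 := add_div_exp_sub_one_mul_le hd hp0
    rw [sub_add_cancel] at h1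
    have h2 := mul_le_mul_of_nonneg_right (div_exp_sub_one_le hβ hβp) hd
    rw [sub_nonneg]
    calc k * (x - p) / α ≤ k * (x - p) / x :=
          div_le_div_of_nonneg_left (mul_nonneg hk hd) hx0 (hxq.trans hqα)
      _ ≤ _ := div_le_div_of_nonneg_right (by rw [hkdef]; linarith) hx0.le
  · refine antitoneOn_of_hasDerivWithinAt_nonpos (convex_Icc q p)
      (fun x hx => (hderiv x (hβ.trans_le (hβq.trans hx.1))).continuousAt.continuousWithinAt)
      (fun x hx =>
        (hderiv x (hβ.trans_le (hβq.trans (interior_subset hx).1))).hasDerivWithinAt)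
      (fun x hx => ?_) (Set.left_mem_Icc.2 hqp) (Set.right_mem_Icc.2 hqp) hqp
    obtain ⟨hqx, hxp⟩ := interior_subset hx
    have hβx : β ≤ x := hβq.trans hqx
    have hx0 : 0 < x := hβ.trans_le hβx
    have hd : 0 ≤ p - x := sub_nonneg.2 hxp
    have hn : 0 ≤ x / (Real.exp x - 1) :=
      div_nonneg hx0.le (sub_nonneg.2 (Real.one_le_exp hx0.le))
    have h1 := mul_le_mul_of_nonneg_left (Real.add_one_le_exp (x - p)) hn
    have h2 := mul_le_mul_of_nonneg_right (div_exp_sub_one_le hβ hβx) hd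
    have h3 : k * (p - x) / α ≤ k * (p - x) / x :=
      div_le_div_of_nonneg_left (mul_nonneg hk hd) hx0 (hxp.trans hpα)
    rw [sub_nonpos]
    calc _ ≤ k * (x - p) / x := div_le_div_of_nonneg_right (by rw [hkdef]; linarith) hx0.le
      _ = -(k * (p - x) / x) := by ring
      _ ≤ -(k * (p - x) / α) := neg_le_neg h3
      _ = k * (x - p) / α := by ring
end

section
/- Let β > 0 and set c_β := (e^β − β − 1)/(e^β − 1). Then for all p, q ≥ β, one has (1 − e^{−p})·D₀(p‖q) ≥ c_β·D(p‖q), where D(p‖q) := p·log(p/q) − (p − q). -/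
/-- KL divergence between two Poisson distributions with parameters `p, q > 0`. -/
noncomputable def poissonKL (p q : ℝ) : ℝ :=
  p * Real.log (p / q) - (p - q)

open Real in
theorem two_mul_exp_sub_one_le_s3 {x : ℝ} (hx : 0 ≤ x) :
    2 * (exp x - 1) ≤ x * (exp x + 1) := by
  have hmono : MonotoneOn (fun y : ℝ => y * (exp y + 1) - 2 * (exp y - 1)) (Set.Ici 0) := by
    apply monotoneOn_of_hasDerivWithinAt_nonneg (convex_Ici 0) (by fun_prop)
      (f' := fun y => 1 * (exp y + 1) + y * exp y - 2 * exp y)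
    · intro y _
      exact (((hasDerivAt_id y).mul ((hasDerivAt_exp y).add_const 1)).sub
        (((hasDerivAt_exp y).sub_const 1).const_mul 2)).hasDerivWithinAt
    · intro y _
      have h1 := mul_le_mul_of_nonneg_left (add_one_le_exp (-y)) (exp_pos y).le
      rw [← exp_add, add_neg_cancel, exp_zero] at h1
      linarith
  have h := hmono Set.self_mem_Ici hx hx
  simp only [zero_mul, exp_zero] at h
  linarith

open Real in
/-- The function `x ↦ (exp x - 1) / x` is supermultiplicative on the nonnegative reals. -/
theorem add_mul_exp_sub_one_mul_le {a b : ℝ} (ha : 0 ≤ a) (hb : 0 ≤ b) :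
    (a + b) * ((exp a - 1) * (exp b - 1)) ≤ a * b * (exp (a + b) - 1) := by
  have hA : 0 ≤ exp a - 1 := by linarith [add_one_le_exp a]
  have hB : 0 ≤ exp b - 1 := by linarith [add_one_le_exp b]
  have h1 := mul_le_mul_of_nonneg_left (two_mul_exp_sub_one_le_s3 ha) (mul_nonneg hb hB)
  have h2 := mul_le_mul_of_nonneg_left (two_mul_exp_sub_one_le_s3 hb) (mul_nonneg ha hA)
  rw [exp_add]
  linarith

open Real in
theorem exp_sub_one_pos {x : ℝ} (hx : 0 < x) : 0 < exp x - 1 := by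
  linarith [add_one_lt_exp hx.ne']

open Real in
theorem div_exp_sub_one_anti {x y : ℝ} (hx : 0 < x) (hxy : x ≤ y) :
    y / (exp y - 1) ≤ x / (exp x - 1) := by
  rw [div_le_div_iff₀ (exp_sub_one_pos (hx.trans_le hxy)) (exp_sub_one_pos hx)]
  obtain ⟨d, rfl⟩ : ∃ d, y = x + d := ⟨y - x, by ring⟩
  have hd : 0 ≤ d := by linarith
  have h1 := mul_le_mul_of_nonneg_left (add_one_le_exp d) (mul_pos hx (exp_pos x)).le
  have h2 := mul_le_mul_of_nonneg_left (add_one_le_exp (-x)) (exp_pos x).le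
  rw [← exp_add, add_neg_cancel, exp_zero] at h2
  have h3 := mul_le_mul_of_nonneg_left h2 hd
  rw [exp_add]
  linarith

open Real in
theorem ztp_slope_le {c p x : ℝ} (hx : 0 < x) (hxp : x ≤ p) (hc : c ≤ 1 - x / (exp x - 1)) :
    (1 - exp (-p)) * (x * exp x / (exp x - 1)) - p ≤ c * (x - p) := by
  have hX := exp_sub_one_pos hx
  have h1 := mul_le_mul_of_nonpos_right hc (sub_nonpos.2 hxp)
  refine le_trans ?_ h1
  have h2 := mul_le_mul_of_nonneg_left (add_one_le_exp (x - p)) hx.le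
  have h3 : exp (x - p) = exp x * exp (-p) := by rw [← exp_add]; rfl
  rw [← sub_nonneg]
  have : (1 - x / (exp x - 1)) * (x - p) - ((1 - exp (-p)) * (x * exp x / (exp x - 1)) - p)
      = (x * exp (x - p) - x * (x - p + 1)) / (exp x - 1) := by
    rw [h3]; field_simp; ring
  rw [this]
  exact div_nonneg (by linarith) hX.le

open Real in
theorem le_ztp_slope {c p x : ℝ} (hp : 0 < p) (hpx : p ≤ x) (hc : c ≤ 1 - p / (exp p - 1)) :
    c * (x - p) ≤ (1 - exp (-p)) * (x * exp x / (exp x - 1)) - p := by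
  have hX := exp_sub_one_pos (hp.trans_le hpx)
  have hP := exp_sub_one_pos hp
  refine (mul_le_mul_of_nonneg_right hc (sub_nonneg.2 hpx)).trans ?_
  have h2 := add_mul_exp_sub_one_mul_le hp.le (sub_nonneg.2 hpx)
  rw [add_sub_cancel] at h2
  have h3 : exp (x - p) = exp x * exp (-p) := by rw [← exp_add]; rfl
  rw [← sub_nonneg]
  have : (1 - exp (-p)) * (x * exp x / (exp x - 1)) - p - (1 - p / (exp p - 1)) * (x - p)
      = (p * (x - p) * (exp x - 1) - x * ((exp p - 1) * (exp (x - p) - 1)))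
        / ((exp x - 1) * (exp p - 1)) := by
    rw [h3]; field_simp; ring
  rw [this]
  exact div_nonneg (by linarith) (mul_pos hX hP).le

open Real in
theorem hasDerivAt_ztp_sub_poisson (c p : ℝ) {x : ℝ} (hx : 0 < x) :
    HasDerivAt (fun y => p * (log p - log y)
        - (1 - exp (-p)) * (log (exp p - 1) - log (exp y - 1))
        - c * (p * (log p - log y) - (p - y)))
      (((1 - exp (-p)) * (x * exp x / (exp x - 1)) - p - c * (x - p)) / x) x := by
  have hX := exp_sub_one_pos hx
  have h1 := ((hasDerivAt_log hx.ne').const_sub (log p)).const_mul p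
  have h2 := ((((hasDerivAt_exp x).sub_const 1).log hX.ne').const_sub
    (log (exp p - 1))).const_mul (1 - exp (-p))
  have h3 := (h1.sub ((hasDerivAt_id x).const_sub p)).const_mul c
  refine ((h1.sub h2).sub h3).congr_deriv ?_
  field_simp
  ring

/-- Core step in the proof of Lemma A.3: with `c_β := (e^β − β − 1)/(e^β − 1)`,
for all `p, q ≥ β > 0`, `(1 − e^{−p})·D₀(p‖q) ≥ c_β·D(p‖q)`. -/
theorem ztp_kl_vs_poisson_kl (β p q : ℝ) (hβ : 0 < β) (hp : β ≤ p) (hq : β ≤ q) :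
    (1 - Real.exp (-p)) * ztpKL p q ≥
      (Real.exp β - β - 1) / (Real.exp β - 1) * poissonKL p q := by
  have hp0 := hβ.trans_le hp
  have hq0 := hβ.trans_le hq
  have hB := exp_sub_one_pos hβ
  set c := (Real.exp β - β - 1) / (Real.exp β - 1) with hc
  have hc_le : ∀ y, β ≤ y → c ≤ 1 - y / (Real.exp y - 1) := fun y hy => by
    have h1 : c = 1 - β / (Real.exp β - 1) := by rw [hc]; field_simp; ring
    linarith [div_exp_sub_one_anti hβ hy]
  have hE : 1 - Real.exp (-p) ≠ 0 := by
    have : Real.exp (-p) < 1 := by simpa using hp0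
    linarith
  set F : ℝ → ℝ := fun y => p * (Real.log p - Real.log y)
        - (1 - Real.exp (-p)) * (Real.log (Real.exp p - 1) - Real.log (Real.exp y - 1))
        - c * (p * (Real.log p - Real.log y) - (p - y)) with hF
  have hFp : F p = 0 := by simp [hF]
  have hFq : (1 - Real.exp (-p)) * ztpKL p q - c * poissonKL p q = F q := by
    rw [ztpKL, poissonKL, Real.log_div hp0.ne' hq0.ne', hF]
    field_simp
  have key : F p ≤ F q := by
    rcases le_total p q with h | h
    · refine monotoneOn_of_hasDerivWithinAt_nonneg (convex_Icc p q)
        (fun x hx => (hasDerivAt_ztp_sub_poisson c p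
          (hp0.trans_le hx.1)).continuousAt.continuousWithinAt)
        (fun x hx => (hasDerivAt_ztp_sub_poisson c p
          (hp0.trans_le (interior_subset hx).1)).hasDerivWithinAt)
        (fun x hx => ?_) (Set.left_mem_Icc.2 h) (Set.right_mem_Icc.2 h) h
      have hx' := interior_subset hx
      exact div_nonneg (sub_nonneg.2 (le_ztp_slope hp0 hx'.1 (hc_le p hp)))
        (hp0.trans_le hx'.1).le
    · refine antitoneOn_of_hasDerivWithinAt_nonpos (convex_Icc q p)
        (fun x hx => (hasDerivAt_ztp_sub_poisson c p
          (hq0.trans_le hx.1)).continuousAt.continuousWithinAt)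
        (fun x hx => (hasDerivAt_ztp_sub_poisson c p
          (hq0.trans_le (interior_subset hx).1)).hasDerivWithinAt)
        (fun x hx => ?_) (Set.left_mem_Icc.2 h) (Set.right_mem_Icc.2 h) h
      have hx' := interior_subset hx
      have hx0 := hq0.trans_le hx'.1
      exact div_nonpos_of_nonpos_of_nonneg
        (sub_nonpos.2 (ztp_slope_le hx0 hx'.2 (hc_le x (hq.trans hx'.1)))) hx0.le
  linarith
end
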